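/- In the repulsive-partition model with B > 9, suppose f₀ ∈ C(t,M,η) with sup|f₀| < B₀ and t ≤ 1, and fix x ∈ (0,1). For all a, u₀, u₁, u₂ > 0 and all δ > 0 small enough, and for every M₁ sufficiently large with M₁ > 2u₀/√δ: E[ 1_{Ω_n} · Π( S : |ȳ_{I_x^S} − f₀(x)| > M₁ ε_n and n_{I_x^S} > s_n(δ) | D_n ) ] = O(n^{−a}). -/

import Mathlib

open MeasureTheory Filter Set ProbabilityTheory
open scoped ENNReal NNReal Classical BigOperators

noncomputable section

namespace Spatial

/-- the mother Haar wavelet ψ = 1_{(0,1/2]} − 1_{(1/2,1]} -/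
def psi (x : ℝ) : ℝ :=
  if x ∈ Set.Ioc (0 : ℝ) (1 / 2) then 1 else if x ∈ Set.Ioc (1 / 2 : ℝ) 1 then -1 else 0

/-- the Haar wavelet ψ_{lk}(x) = 2^{l/2} ψ(2^l x − k) -/
def haar (l k : ℕ) (x : ℝ) : ℝ := (2 : ℝ) ^ ((l : ℝ) / 2) * psi ((2 : ℝ) ^ l * x - k)

/-- the father wavelet ψ_{−1,0} = 1_{[0,1]} -/
def father (x : ℝ) : ℝ := if x ∈ Set.Icc (0 : ℝ) 1 then 1 else 0

/-- the dyadic interval I_{lk} = (k 2^{−l}, (k+1) 2^{−l}] -/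
def dyadic (l k : ℕ) : Set ℝ := Set.Ioc ((k : ℝ) / 2 ^ l) (((k : ℝ) + 1) / 2 ^ l)

/-- the Haar coefficient β⁰_{lk} = ∫₀¹ f ψ_{lk} -/
def coef (f : ℝ → ℝ) (l k : ℕ) : ℝ := ∫ x in Set.Ioc (0 : ℝ) 1, f x * haar l k x

/-- the father coefficient ⟨f, ψ_{−1,0}⟩ -/
def coefFather (f : ℝ → ℝ) : ℝ := ∫ x in Set.Ioc (0 : ℝ) 1, f x

/-- k_l(x) : the index k with x ∈ I_{lk} (for x ∈ (0,1]) -/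
def kAt (l : ℕ) (x : ℝ) : ℕ := ⌈(2 : ℝ) ^ l * x⌉₊ - 1

/-- f belongs to the local Hölder class C(t,x,M,η) at the point x -/
def HolderAt (f : ℝ → ℝ) (t M η : ℝ) (x : ℝ) : Prop :=
  (∀ y ∈ Set.Icc (0 : ℝ) 1, |f y| ≤ M) ∧
    ∀ m : ℝ, m ≠ 0 → |m| ≤ η → x + m ∈ Set.Icc (0 : ℝ) 1 →
      |f (x + m) - f x| ≤ M * |m| ^ t

/-- the class C(t,M,η) of locally Hölder functions -/
def HolderClass (t M η : ℝ → ℝ) : Set (ℝ → ℝ) :=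
  {f | ∀ x ∈ Set.Icc (0 : ℝ) 1, HolderAt f (t x) (M x) (η x) x}

/-- Assumption A1 on the smoothness functions t, M, η -/
structure A1 (t M η : ℝ → ℝ) (t₁ : ℝ) : Prop where
  ht₁ : 0 < t₁
  t_lb : ∀ x ∈ Set.Icc (0 : ℝ) 1, t₁ ≤ t x
  t_ub : ∀ x ∈ Set.Icc (0 : ℝ) 1, t x ≤ 1
  M_ub : ∃ Mmax > 0, ∀ x ∈ Set.Icc (0 : ℝ) 1, M x ≤ Mmax
  M_lb : ∃ Mmin > 0, ∀ x ∈ Set.Icc (0 : ℝ) 1, Mmin ≤ M x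
  eta_ub : ∃ emax > 0, ∀ x ∈ Set.Icc (0 : ℝ) 1, η x ≤ emax
  eta_lb : ∃ emin > 0, ∀ x ∈ Set.Icc (0 : ℝ) 1, emin ≤ η x

/-- η_{lk} = min_{y ∈ I_{lk}} η(y) -/
def etaLK (η : ℝ → ℝ) (l k : ℕ) : ℝ := sInf (η '' dyadic l k)

/-- M_{lk} = max_{y ∈ I_{lk}} M(y) -/
def MLK (M : ℝ → ℝ) (l k : ℕ) : ℝ := sSup (M '' dyadic l k)

/-- the local rate ζ_n(x) = (n/log n)^{t(x)/(2t(x)+1)} -/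
def zeta (t : ℝ → ℝ) (n : ℕ) (x : ℝ) : ℝ :=
  ((n : ℝ) / Real.log n) ^ (t x / (2 * t x + 1))

/-- maximal resolution L_max = ⌊log₂ n⌋ -/
def Lmax (n : ℕ) : ℕ := Nat.log 2 n

/-- C_l(x) = (2 M_{l k_l(x)}/γ̄)^{1/(t(x)+1/2)} -/
def Cl (t M : ℝ → ℝ) (γ : ℝ) (l : ℕ) (x : ℝ) : ℝ :=
  (2 * MLK M l (kAt l x) / γ) ^ ((1 : ℝ) / (t x + 1 / 2))

/-- the local depth d_l(x) -/
def dloc (t M : ℝ → ℝ) (γ : ℝ) (n l : ℕ) (x : ℝ) : ℝ :=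
  (⌊Real.logb 2 (Cl t M γ l x * ((n : ℝ) / Real.log n) ^ ((1 : ℝ) / (2 * t x + 1)))⌋ : ℝ)

/-- the adjusted local depth d̃_l(x) -/
def dTilde (t M η : ℝ → ℝ) (γ : ℝ) (n l : ℕ) (x : ℝ) : ℝ :=
  max (Real.logb 2 (1 / (2 * etaLK η l (kAt l x)))) (dloc t M γ n l x)

/-! ## The repulsive partition model -/

/-- knots of the grid -/
abbrev Knot (N : ℕ) := Fin (N + 1)

/-- the grid z₀ = 0 < … < z_N = 1 with spacing between C₁ log n/n and C₂ log n/n -/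
def IsGrid (n N : ℕ) (z : Knot N → ℝ) (C₁ C₂ : ℝ) : Prop :=
  z 0 = 0 ∧ z (Fin.last N) = 1 ∧
    ∀ i : Fin N,
      C₁ * Real.log n / n ≤ z i.succ - z i.castSucc ∧
      z i.succ - z i.castSucc ≤ C₂ * Real.log n / n

/-- a subset of knots defining a partition of [0,1] -/
def IsPart (N : ℕ) (S : Finset (Knot N)) : Prop := 0 ∈ S ∧ Fin.last N ∈ S

/-- i and j are consecutive knots of S (so that (z_i, z_j] is a block of S) -/
def Consec (N : ℕ) (S : Finset (Knot N)) (i j : Knot N) : Prop :=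
  i ∈ S ∧ j ∈ S ∧ i < j ∧ ∀ m ∈ S, ¬(i < m ∧ m < j)

/-- the (unnormalised) repulsive prior weight π_S(S) ∝ Π_j |I_j^S|^B -/
def partWeight (N : ℕ) (z : Knot N → ℝ) (B : ℝ) (S : Finset (Knot N)) : ℝ :=
  if IsPart N S then
    ∏ q ∈ Finset.univ.filter (fun q : Knot N × Knot N => Consec N S q.1 q.2),
      (z q.2 - z q.1) ^ B
  else 0

/-- conditions on the coefficient densities g_j: bounded above by c₁ and below by c₀
on [−B₀,B₀], nonnegative probability densities -/
def GoodDens (N : ℕ) (g : Knot N → ℝ → ℝ) (c₀ c₁ B₀ : ℝ) : Prop :=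
  ∀ i : Knot N,
    (∀ b : ℝ, |b| ≤ B₀ → c₀ ≤ g i b) ∧ (∀ b : ℝ, 0 ≤ g i b) ∧
      (∀ b : ℝ, g i b ≤ c₁) ∧ (∫ b : ℝ, g i b) = 1

/-- the conditional prior on the block coefficients given a partition S -/
def partCondPrior (N : ℕ) (g : Knot N → ℝ → ℝ) (S : Finset (Knot N)) :
    Measure (Knot N → ℝ) :=
  Measure.map
    (fun v : {i : Knot N // i ∈ S.erase 0} → ℝ =>
      fun i => if h : i ∈ S.erase 0 then v ⟨i, h⟩ else 0)
    ((volume : Measure ({i : Knot N // i ∈ S.erase 0} → ℝ)).withDensity fun v =>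
      ENNReal.ofReal (∏ i, g i.1 (v i)))

/-- the step function f_β^S = Σ_j β_j 1_{I_j^S} (the block (z_i,z_j] carries the
coefficient indexed by its right knot j) -/
def fPart (N : ℕ) (z : Knot N → ℝ) (S : Finset (Knot N)) (β : Knot N → ℝ) (x : ℝ) : ℝ :=
  ∑ j : Knot N, ∑ i : Knot N,
    if Consec N S i j ∧ x ∈ Set.Ioc (z i) (z j) then β j else 0

/-- the regression log-likelihood -/
def partLoglik (n N : ℕ) (z : Knot N → ℝ) (xd : Fin n → ℝ) (Y : Fin n → ℝ)
    (S : Finset (Knot N)) (β : Knot N → ℝ) : ℝ :=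
  -(1 / 2 : ℝ) * ∑ i, (Y i - fPart N z S β (xd i)) ^ 2

/-- the posterior probability of an event A about (S,β) -/
def partPost (n N : ℕ) (z : Knot N → ℝ) (xd : Fin n → ℝ) (B : ℝ)
    (g : Knot N → ℝ → ℝ) (Y : Fin n → ℝ)
    (A : Finset (Knot N) → (Knot N → ℝ) → Prop) : ℝ :=
  (∑ S : Finset (Knot N), partWeight N z B S *
      ∫ β, (if A S β then (1 : ℝ) else 0) * Real.exp (partLoglik n N z xd Y S β)
        ∂partCondPrior N g S) /
    ∑ S : Finset (Knot N), partWeight N z B S *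
      ∫ β, Real.exp (partLoglik n N z xd Y S β) ∂partCondPrior N g S

/-- n_I : number of design points in (a,b] -/
def nIv (n : ℕ) (xd : Fin n → ℝ) (a b : ℝ) : ℕ :=
  (Finset.univ.filter fun i => xd i ∈ Set.Ioc a b).card

/-- ȳ_I : the mean of Y over the design points in (a,b] -/
def ybar (n : ℕ) (xd : Fin n → ℝ) (Y : Fin n → ℝ) (a b : ℝ) : ℝ :=
  (∑ i ∈ Finset.univ.filter fun i => xd i ∈ Set.Ioc a b, Y i) / nIv n xd a b

/-- the intervals arising as the block I_x^S of some partition S ∈ 𝕊 -/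
def IxPairs (N : ℕ) (z : Knot N → ℝ) (x : ℝ) : Set (Knot N × Knot N) :=
  {q | ∃ S : Finset (Knot N), IsPart N S ∧ Consec N S q.1 q.2 ∧
    x ∈ Set.Ioc (z q.1) (z q.2)}

/-- the intervals I(x) : blocks of some S which contain x or are adjacent to the
block of S containing x -/
def IcalPairs (N : ℕ) (z : Knot N → ℝ) (x : ℝ) : Set (Knot N × Knot N) :=
  {q | ∃ S : Finset (Knot N), IsPart N S ∧ Consec N S q.1 q.2 ∧
    (x ∈ Set.Ioc (z q.1) (z q.2) ∨
      ∃ i j : Knot N, Consec N S i j ∧ x ∈ Set.Ioc (z i) (z j) ∧ (q.1 = j ∨ q.2 = i))}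

/-- n_{I_x^S} -/
def nIx (n N : ℕ) (xd : Fin n → ℝ) (z : Knot N → ℝ) (S : Finset (Knot N)) (x : ℝ) : ℝ :=
  ∑ i : Knot N, ∑ j : Knot N,
    if Consec N S i j ∧ x ∈ Set.Ioc (z i) (z j) then (nIv n xd (z i) (z j) : ℝ) else 0

/-- ȳ_{I_x^S} -/
def ybarIx (n N : ℕ) (xd : Fin n → ℝ) (z : Knot N → ℝ) (Y : Fin n → ℝ)
    (S : Finset (Knot N)) (x : ℝ) : ℝ :=
  ∑ i : Knot N, ∑ j : Knot N,
    if Consec N S i j ∧ x ∈ Set.Ioc (z i) (z j) then ybar n xd Y (z i) (z j) else 0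

/-- the design event Ω_{n,x}(u₁) -/
def OmegaX (n N : ℕ) (xd : Fin n → ℝ) (z : Knot N → ℝ) (pI : ℝ → ℝ → ℝ)
    (u₁ : ℝ) (x : ℝ) : Prop :=
  ∀ q ∈ IcalPairs N z x,
    |(nIv n xd (z q.1) (z q.2) : ℝ) - n * pI (z q.1) (z q.2)| ≤
      u₁ * Real.sqrt (Real.log n * (n * pI (z q.1) (z q.2)))

/-- the noise event Ω_{n,y}(u₀) -/
def OmegaY (n N : ℕ) (xd : Fin n → ℝ) (z : Knot N → ℝ) (u₀ : ℝ) (x : ℝ)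
    (ε : Fin n → ℝ) : Prop :=
  ∀ q ∈ IxPairs N z x,
    |ybar n xd ε (z q.1) (z q.2)| ≤
      u₀ * Real.sqrt (Real.log n / nIv n xd (z q.1) (z q.2))

/-- the noise event Ω_{n,y,2}(u₂) -/
def OmegaY2 (n N : ℕ) (xd : Fin n → ℝ) (z : Knot N → ℝ) (u₂ : ℝ) (x : ℝ)
    (ε : Fin n → ℝ) : Prop :=
  ∀ q ∈ IcalPairs N z x,
    |ybar n xd ε (z q.1) (z q.2)| ≤
      u₂ * Real.sqrt (Real.log n / nIv n xd (z q.1) (z q.2))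

/-- the local rate ε_n(x) = (n/log n)^{−t(x)/(2t(x)+1)} -/
def epsn (t : ℝ → ℝ) (n : ℕ) (x : ℝ) : ℝ :=
  ((n : ℝ) / Real.log n) ^ (-(t x) / (2 * t x + 1))

/-- s_n(δ) = δ log n / ε_n² -/
def snD (t : ℝ → ℝ) (n : ℕ) (x : ℝ) (δ : ℝ) : ℝ :=
  δ * Real.log n / epsn t n x ^ 2

/-- the standard Gaussian on ℝ -/
def stdGaussian : Measure ℝ := ProbabilityTheory.gaussianReal 0 1

/-- the regression noise distribution -/
def regNoise (n : ℕ) : Measure (Fin n → ℝ) := Measure.pi fun _ => stdGaussian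

/-- Assumption A4: the smoothness exponent t is piecewise Hölder -/
def A4 (t : ℝ → ℝ) : Prop :=
  ∃ k : ℕ, ∃ a : Fin (k + 2) → ℝ, a 0 = 0 ∧ a (Fin.last (k + 1)) = 1 ∧ StrictMono a ∧
    ∃ L₀ > (0 : ℝ), ∀ j : Fin (k + 1), ∃ α > (0 : ℝ),
      (∀ x ∈ Set.Ioo (a j.castSucc) (a j.succ), ∀ y ∈ Set.Ioo (a j.castSucc) (a j.succ),
        |t x - t y| ≤ L₀ * |x - y| ^ α) ∧
      (∀ x ∈ Set.Ioo (a j.castSucc) (a j.succ),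
        |t x - t (a j.castSucc)| ≤ L₀ * |x - a j.castSucc| ^ α ∧
        |t x - t (a j.succ)| ≤ L₀ * |x - a j.succ| ^ α)

/-! ### Consecutive knots of a partition -/

section Cells

variable {N : ℕ} {S : Finset (Knot N)}

/-- the pairs of consecutive knots of `S` -/
def cells (N : ℕ) (S : Finset (Knot N)) : Finset (Knot N × Knot N) :=
  Finset.univ.filter fun q => Consec N S q.1 q.2

theorem mem_cells {q : Knot N × Knot N} : q ∈ cells N S ↔ Consec N S q.1 q.2 := by
  simp [cells]

theorem Consec.left_unique {i i' j : Knot N} (h : Consec N S i j) (h' : Consec N S i' j) :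
    i = i' := by
  obtain ⟨h1, h2, h3, h4⟩ := h
  obtain ⟨h1', h2', h3', h4'⟩ := h'
  rcases lt_trichotomy i i' with hl | hl | hl
  · exact (h4 i' h1' ⟨hl, h3'⟩).elim
  · exact hl
  · exact (h4' i h1 ⟨hl, h3⟩).elim

theorem Consec.unique {z : Knot N → ℝ} (hz : StrictMono z) {i i' j j' : Knot N} {y : ℝ}
    (h : Consec N S i j) (h' : Consec N S i' j') (hy : y ∈ Set.Ioc (z i) (z j))
    (hy' : y ∈ Set.Ioc (z i') (z j')) : i = i' ∧ j = j' := by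
  have key : ∀ {i i' j j' : Knot N}, Consec N S i j → Consec N S i' j' →
      y ∈ Set.Ioc (z i) (z j) → y ∈ Set.Ioc (z i') (z j') → ¬ j < j' := by
    intro i i' j j' h h' hy hy' hl
    exact h'.2.2.2 j h.2.1 ⟨hz.lt_iff_lt.1 (hy'.1.trans_le hy.2), hl⟩
  have hj : j = j' := le_antisymm (not_lt.1 (key h' h hy' hy)) (not_lt.1 (key h h' hy hy'))
  subst hj
  exact ⟨h.left_unique h', rfl⟩

theorem exists_consec_mem {z : Knot N → ℝ} (hz : StrictMono z) (hS : IsPart N S) {y : ℝ}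
    (hy : y ∈ Set.Ioc (z 0) (z (Fin.last N))) :
    ∃ i j, Consec N S i j ∧ y ∈ Set.Ioc (z i) (z j) := by
  have hl : (S.filter fun k => z k < y).Nonempty := ⟨0, by simp [hS.1, hy.1]⟩
  have hr : (S.filter fun k => y ≤ z k).Nonempty := ⟨Fin.last N, by simp [hS.2, hy.2]⟩
  obtain ⟨hi, hi'⟩ := Finset.mem_filter.1 (Finset.max'_mem _ hl)
  obtain ⟨hj, hj'⟩ := Finset.mem_filter.1 (Finset.min'_mem _ hr)
  refine ⟨_, _, ⟨hi, hj, hz.lt_iff_lt.1 (hi'.trans_le hj'), ?_⟩, hi', hj'⟩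
  rintro m hm ⟨h1, h2⟩
  rcases lt_or_ge (z m) y with h | h
  · exact absurd (Finset.le_max' _ m (Finset.mem_filter.2 ⟨hm, h⟩)) (not_le.2 h1)
  · exact absurd (Finset.min'_le _ m (Finset.mem_filter.2 ⟨hm, h⟩)) (not_le.2 h2)

theorem exists_consec_left (h0 : 0 ∈ S) {j : Knot N} (hj : j ∈ S.erase 0) :
    ∃ i, Consec N S i j := by
  obtain ⟨hj0, hjS⟩ := Finset.mem_erase.1 hj
  have hl : (S.filter fun k => k < j).Nonempty := ⟨0, by simp [h0, Fin.pos_iff_ne_zero, hj0]⟩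
  obtain ⟨hi, hi'⟩ := Finset.mem_filter.1 (Finset.max'_mem _ hl)
  refine ⟨_, hi, hjS, hi', ?_⟩
  rintro m hm ⟨h1, h2⟩
  exact absurd (Finset.le_max' _ m (Finset.mem_filter.2 ⟨hm, h2⟩)) (not_le.2 h1)

theorem Consec.right_mem_erase {i j : Knot N} (h : Consec N S i j) : j ∈ S.erase 0 :=
  Finset.mem_erase.2 ⟨(lt_of_le_of_lt (Fin.zero_le i) h.2.2.1).ne', h.2.1⟩

theorem cells_eq_image {p : {i : Knot N // i ∈ S.erase 0} → Knot N}
    (hp : ∀ i, Consec N S (p i) i) :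
    cells N S = Finset.univ.image fun i : {i : Knot N // i ∈ S.erase 0} => (p i, i.1) := by
  ext ⟨i, j⟩
  simp only [mem_cells, Finset.mem_image, Finset.mem_univ, true_and, Prod.mk.injEq]
  constructor
  · intro h
    exact ⟨⟨j, h.right_mem_erase⟩, (hp ⟨j, h.right_mem_erase⟩).left_unique h, rfl⟩
  · rintro ⟨k, rfl, rfl⟩
    exact hp k

theorem prod_cells {p : {i : Knot N // i ∈ S.erase 0} → Knot N} (hp : ∀ i, Consec N S (p i) i)
    (F : Knot N × Knot N → ℝ) : ∏ q ∈ cells N S, F q = ∏ i, F (p i, i.1) := by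
  rw [cells_eq_image hp, Finset.prod_image]
  intro a _ b _ hab
  exact Subtype.ext (Prod.mk.inj hab).2

theorem sum_cells {p : {i : Knot N // i ∈ S.erase 0} → Knot N} (hp : ∀ i, Consec N S (p i) i)
    (F : Knot N × Knot N → ℝ) : ∑ q ∈ cells N S, F q = ∑ i, F (p i, i.1) := by
  rw [cells_eq_image hp, Finset.sum_image]
  intro a _ b _ hab
  exact Subtype.ext (Prod.mk.inj hab).2

theorem sum_ite_consec {z : Knot N → ℝ} (hz : StrictMono z) {i j : Knot N} {y : ℝ}
    (h : Consec N S i j) (hy : y ∈ Set.Ioc (z i) (z j)) (F : Knot N → Knot N → ℝ) :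
    (∑ k : Knot N, ∑ l : Knot N,
      if Consec N S k l ∧ y ∈ Set.Ioc (z k) (z l) then F k l else 0) = F i j := by
  rw [Finset.sum_eq_single i, Finset.sum_eq_single j, if_pos ⟨h, hy⟩]
  · intro l _ hl
    rw [if_neg]
    exact fun h' => hl (h.unique hz h'.1 hy h'.2).2.symm
  · simp
  · intro k _ hk
    refine Finset.sum_eq_zero fun l _ => ?_
    rw [if_neg]
    exact fun h' => hk (h.unique hz h'.1 hy h'.2).1.symm
  · simp

theorem IsPart.insert (hS : IsPart N S) (m : Knot N) : IsPart N (insert m S) :=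
  ⟨Finset.mem_insert_of_mem hS.1, Finset.mem_insert_of_mem hS.2⟩

theorem Consec.insert_left {i j m : Knot N} (h : Consec N S i j) (hi : i < m) (hj : m < j) :
    Consec N (insert m S) i m := by
  refine ⟨Finset.mem_insert_of_mem h.1, Finset.mem_insert_self _ _, hi, ?_⟩
  rintro k hk ⟨h1, h2⟩
  rcases Finset.mem_insert.1 hk with rfl | hk
  · exact lt_irrefl _ h2
  · exact h.2.2.2 k hk ⟨h1, h2.trans hj⟩

theorem Consec.insert_right {i j m : Knot N} (h : Consec N S i j) (hi : i < m) (hj : m < j) :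
    Consec N (insert m S) m j := by
  refine ⟨Finset.mem_insert_self _ _, Finset.mem_insert_of_mem h.2.1, hj, ?_⟩
  rintro k hk ⟨h1, h2⟩
  rcases Finset.mem_insert.1 hk with rfl | hk
  · exact lt_irrefl _ h1
  · exact h.2.2.2 k hk ⟨hi.trans h1, h2⟩

theorem Consec.cells_insert {i j m : Knot N} (h : Consec N S i j) (hi : i < m) (hj : m < j) :
    cells N (insert m S) =
      insert (i, m) (insert (m, j) ((cells N S).erase (i, j))) := by
  have hm : m ∉ S := fun hm => h.2.2.2 m hm ⟨hi, hj⟩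
  ext ⟨k, l⟩
  simp only [Finset.mem_insert, Finset.mem_erase, mem_cells, Prod.mk.injEq, ne_eq]
  constructor
  · intro hkl
    by_cases hlm : l = m
    · subst hlm
      exact Or.inl ⟨hkl.left_unique (h.insert_left hi hj), rfl⟩
    · have hlS : l ∈ S := (Finset.mem_insert.1 hkl.2.1).resolve_left hlm
      by_cases hkm : k = m
      · subst hkm
        refine Or.inr (Or.inl ⟨rfl, ?_⟩)
        rcases lt_trichotomy l j with hl | hl | hl
        · exact (h.2.2.2 l hlS ⟨hi.trans hkl.2.2.1, hl⟩).elim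
        · exact hl
        · exact (hkl.2.2.2 j (Finset.mem_insert_of_mem h.2.1) ⟨hj, hl⟩).elim
      · have hkS : k ∈ S := (Finset.mem_insert.1 hkl.1).resolve_left hkm
        refine Or.inr (Or.inr ⟨?_, hkS, hlS, hkl.2.2.1,
          fun p hp => hkl.2.2.2 p (Finset.mem_insert_of_mem hp)⟩)
        rintro ⟨rfl, rfl⟩
        exact hkl.2.2.2 m (Finset.mem_insert_self _ _) ⟨hi, hj⟩
  · rintro (⟨rfl, rfl⟩ | ⟨rfl, rfl⟩ | ⟨hne, hkl⟩)
    · exact h.insert_left hi hj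
    · exact h.insert_right hi hj
    · refine ⟨Finset.mem_insert_of_mem hkl.1, Finset.mem_insert_of_mem hkl.2.1, hkl.2.2.1, ?_⟩
      rintro p hp ⟨h1, h2⟩
      rcases Finset.mem_insert.1 hp with rfl | hp
      · have hki : k ≤ i := by
          by_contra hc
          exact h.2.2.2 k hkl.1 ⟨not_le.1 hc, h1.trans hj⟩
        have hik : i ≤ k := by
          by_contra hc
          exact hkl.2.2.2 i h.1 ⟨not_le.1 hc, hi.trans h2⟩
        have hjl : j ≤ l := by
          by_contra hc
          exact h.2.2.2 l hkl.2.1 ⟨hi.trans h2, not_le.1 hc⟩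
        have hlj : l ≤ j := by
          by_contra hc
          exact hkl.2.2.2 j h.2.1 ⟨h1.trans hj, not_le.1 hc⟩
        exact hne ⟨le_antisymm hki hik, le_antisymm hlj hjl⟩
      · exact hkl.2.2.2 p hp ⟨h1, h2⟩

theorem Consec.prod_cells_insert {i j m : Knot N} (h : Consec N S i j) (hi : i < m) (hj : m < j)
    (F : Knot N × Knot N → ℝ) :
    (∏ q ∈ cells N (insert m S), F q) * F (i, j) =
      (∏ q ∈ cells N S, F q) * (F (i, m) * F (m, j)) := by
  have hm : m ∉ S := fun hm => h.2.2.2 m hm ⟨hi, hj⟩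
  rw [h.cells_insert hi hj, Finset.prod_insert, Finset.prod_insert,
    ← Finset.mul_prod_erase (cells N S) F ((mem_cells (q := (i, j))).2 h)]
  · ring
  · simp only [Finset.mem_erase, mem_cells, not_and]
    exact fun _ h' => hm h'.1
  · simp only [Finset.mem_insert, Finset.mem_erase, mem_cells, Prod.mk.injEq, not_or]
    exact ⟨fun h' => hi.ne h'.1, fun h' => hm h'.2.2.1⟩

theorem consec_span {i j : Knot N} (hij : i < j) :
    Consec N ({0, i, j, Fin.last N} : Finset (Knot N)) i j := by
  refine ⟨by simp, by simp, hij, ?_⟩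
  rintro m hm ⟨h1, h2⟩
  simp only [Finset.mem_insert, Finset.mem_singleton] at hm
  rcases hm with rfl | rfl | rfl | rfl
  · exact absurd h1 (not_lt.2 (Fin.zero_le _))
  · exact lt_irrefl _ h1
  · exact lt_irrefl _ h2
  · exact absurd h2 (not_lt.2 (Fin.le_last _))

theorem isPart_span (i j : Knot N) : IsPart N ({0, i, j, Fin.last N} : Finset (Knot N)) :=
  ⟨by simp, by simp⟩

theorem mem_IxPairs {z : Knot N → ℝ} {x : ℝ} {i j : Knot N} (hij : i < j)
    (hx : x ∈ Set.Ioc (z i) (z j)) : (i, j) ∈ IxPairs N z x :=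
  ⟨_, isPart_span i j, consec_span hij, hx⟩

theorem mem_IcalPairs {z : Knot N → ℝ} {x : ℝ}
    (hx : x ∈ Set.Ioc (z 0) (z (Fin.last N))) {i j : Knot N} (hij : i < j) :
    (i, j) ∈ IcalPairs N z x := by
  refine ⟨_, isPart_span i j, consec_span hij, ?_⟩
  by_cases h1 : z i < x
  · by_cases h2 : x ≤ z j
    · exact Or.inl ⟨h1, h2⟩
    · rw [not_le] at h2
      refine Or.inr ⟨j, Fin.last N, ⟨by simp, by simp, ?_, ?_⟩, ⟨h2, hx.2⟩, Or.inr rfl⟩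
      · exact lt_of_le_of_ne (Fin.le_last j) (by rintro rfl; exact not_le.2 h2 hx.2)
      · rintro m hm ⟨h3, h4⟩
        simp only [Finset.mem_insert, Finset.mem_singleton] at hm
        rcases hm with rfl | rfl | rfl | rfl
        · exact absurd h3 (not_lt.2 (Fin.zero_le _))
        · exact lt_asymm h3 hij
        · exact lt_irrefl _ h3
        · exact lt_irrefl _ h4
  · rw [not_lt] at h1
    refine Or.inr ⟨0, i, ⟨by simp, by simp, ?_, ?_⟩, ⟨hx.1, h1⟩, Or.inl rfl⟩
    · exact lt_of_le_of_ne (Fin.zero_le i) (by rintro rfl; exact not_le.2 hx.1 h1)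
    · rintro m hm ⟨h3, h4⟩
      simp only [Finset.mem_insert, Finset.mem_singleton] at hm
      rcases hm with rfl | rfl | rfl | rfl
      · exact lt_irrefl _ h3
      · exact lt_irrefl _ h4
      · exact lt_asymm h4 hij
      · exact absurd h4 (not_lt.2 (Fin.le_last _))

end Cells

/-! ### Factorisation of the marginal likelihood over blocks -/

section Marginal

variable {n N : ℕ}

/-- the sum of squares of `Y - c` over the design points in `(a, b]` -/
def blockSq (xd Y : Fin n → ℝ) (a b c : ℝ) : ℝ :=
  ∑ i ∈ Finset.univ.filter fun i => xd i ∈ Set.Ioc a b, (Y i - c) ^ 2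

/-- the sum of squares of `Y` over the design points outside `(a, b]` -/
def outerSq (xd Y : Fin n → ℝ) (a b : ℝ) : ℝ :=
  ∑ i ∈ Finset.univ.filter fun i => xd i ∉ Set.Ioc a b, Y i ^ 2

/-- the marginal likelihood of a block with coefficient density `g` -/
def blockMarg (xd Y : Fin n → ℝ) (g : ℝ → ℝ) (a b : ℝ) : ℝ :=
  ∫ β, g β * Real.exp (-(1 / 2 : ℝ) * blockSq xd Y a b β)

theorem continuous_blockSq (xd Y : Fin n → ℝ) (a b : ℝ) : Continuous (blockSq xd Y a b) := by
  unfold blockSq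
  fun_prop

theorem fPart_eq {z : Knot N → ℝ} (hz : StrictMono z) {S : Finset (Knot N)} {i j : Knot N}
    {y : ℝ} (h : Consec N S i j) (hy : y ∈ Set.Ioc (z i) (z j)) (β : Knot N → ℝ) :
    fPart N z S β y = β j := by
  rw [fPart, Finset.sum_comm]
  exact sum_ite_consec hz h hy fun _ l => β l

theorem fPart_eq_zero {z : Knot N → ℝ} (hz : StrictMono z) {S : Finset (Knot N)} {y : ℝ}
    (hy : y ∉ Set.Ioc (z 0) (z (Fin.last N))) (β : Knot N → ℝ) : fPart N z S β y = 0 := by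
  refine Finset.sum_eq_zero fun l _ => Finset.sum_eq_zero fun k _ => ?_
  rw [if_neg]
  rintro ⟨-, h⟩
  exact hy ⟨(hz.monotone (Fin.zero_le k)).trans_lt h.1, h.2.trans (hz.monotone (Fin.le_last l))⟩

theorem sum_cells_ite {z : Knot N → ℝ} (hz : StrictMono z) {S : Finset (Knot N)} {i j : Knot N}
    {y : ℝ} (h : Consec N S i j) (hy : y ∈ Set.Ioc (z i) (z j)) (F : Knot N × Knot N → ℝ) :
    (∑ q ∈ cells N S, if y ∈ Set.Ioc (z q.1) (z q.2) then F q else 0) = F (i, j) := by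
  rw [Finset.sum_eq_single (i, j), if_pos hy]
  · rintro ⟨k, l⟩ hq hne
    rw [if_neg]
    intro h'
    obtain ⟨rfl, rfl⟩ := h.unique hz (mem_cells.1 hq) hy h'
    exact hne rfl
  · exact fun h' => absurd ((mem_cells (q := (i, j))).2 h) h'

theorem partLoglik_eq {z : Knot N → ℝ} (hz : StrictMono z) {S : Finset (Knot N)}
    (hS : IsPart N S) (xd Y : Fin n → ℝ) (β : Knot N → ℝ) :
    partLoglik n N z xd Y S β =
      -(1 / 2 : ℝ) * (outerSq xd Y (z 0) (z (Fin.last N)) +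
        ∑ q ∈ cells N S, blockSq xd Y (z q.1) (z q.2) (β q.2)) := by
  unfold partLoglik outerSq blockSq
  congr 1
  simp only [Finset.sum_filter]
  rw [Finset.sum_comm, ← Finset.sum_add_distrib]
  refine Finset.sum_congr rfl fun k _ => ?_
  by_cases hk : xd k ∈ Set.Ioc (z 0) (z (Fin.last N))
  · obtain ⟨i, j, h, hy⟩ := exists_consec_mem hz hS hk
    rw [sum_cells_ite hz h hy fun q => (Y k - β q.2) ^ 2, fPart_eq hz h hy, if_neg (not_not.2 hk),
      zero_add]
  · rw [fPart_eq_zero hz hk, if_pos hk, sub_zero, Finset.sum_eq_zero, add_zero]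
    rintro ⟨i, j⟩ _
    rw [if_neg]
    exact fun h => hk ⟨(hz.monotone (Fin.zero_le i)).trans_lt h.1,
      h.2.trans (hz.monotone (Fin.le_last j))⟩

theorem aestronglyMeasurable_of_integral_eq_one {f : ℝ → ℝ} (hf : ∫ b, f b = 1) :
    AEStronglyMeasurable f volume := by
  refine Integrable.aestronglyMeasurable (by_contra fun h => ?_)
  rw [integral_undef h] at hf
  exact zero_ne_one hf

theorem integral_exp_partLoglik {z : Knot N → ℝ} (hz : StrictMono z) {S : Finset (Knot N)}
    (hS : IsPart N S) (xd Y : Fin n → ℝ) {g : Knot N → ℝ → ℝ} (hg0 : ∀ i b, 0 ≤ g i b)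
    (hg1 : ∀ i, ∫ b, g i b = 1) :
    ∫ β, Real.exp (partLoglik n N z xd Y S β) ∂partCondPrior N g S =
      Real.exp (-(1 / 2 : ℝ) * outerSq xd Y (z 0) (z (Fin.last N))) *
        ∏ q ∈ cells N S, blockMarg xd Y (g q.2) (z q.1) (z q.2) := by
  choose p hp using fun i : {i : Knot N // i ∈ S.erase 0} => exists_consec_left hS.1 i.2
  simp only [partLoglik_eq hz hS, sum_cells hp, prod_cells hp]
  rw [partCondPrior, integral_map]
  · rw [integral_withDensity_eq_integral_toReal_smul₀]
    · simp only [blockMarg]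
      rw [← integral_fintype_prod_volume_eq_prod
        fun (i : {i : Knot N // i ∈ S.erase 0}) b =>
          g i.1 b * Real.exp (-(1 / 2 : ℝ) * blockSq xd Y (z (p i)) (z i.1) b),
        ← integral_const_mul]
      refine integral_congr_ae (ae_of_all _ fun v => ?_)
      have hv : ∀ i : {i : Knot N // i ∈ S.erase 0},
          (if h : i.1 ∈ S.erase 0 then v ⟨i.1, h⟩ else 0) = v i := fun i => dif_pos i.2
      simp only [hv]
      rw [ENNReal.toReal_ofReal (Finset.prod_nonneg fun i _ => hg0 _ _), smul_eq_mul, mul_add,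
        Real.exp_add, Finset.mul_sum, Real.exp_sum, Finset.prod_mul_distrib]
      ring
    · refine AEMeasurable.ennreal_ofReal ?_
      refine Finset.aemeasurable_fun_prod _ fun i _ => ?_
      exact (aestronglyMeasurable_of_integral_eq_one (hg1 i)).aemeasurable.comp_quasiMeasurePreserving
        (Measure.quasiMeasurePreserving_eval _ i)
    · exact ae_of_all _ fun _ => ENNReal.ofReal_lt_top
  · refine Measurable.aemeasurable (measurable_pi_lambda _ fun i => ?_)
    by_cases h : i ∈ S.erase 0
    · simp only [h, dif_pos]
      exact measurable_pi_apply _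
    · simp only [h, dif_neg, not_false_eq_true]
      exact measurable_const
  · have := continuous_blockSq xd Y
    refine Continuous.aestronglyMeasurable ?_
    fun_prop

end Marginal

/-! ### Bounds for a single block -/

section Block

variable {n : ℕ}

theorem ybar_mul_nIv (xd Y : Fin n → ℝ) (a b : ℝ) :
    (nIv n xd a b : ℝ) * ybar n xd Y a b =
      ∑ i ∈ Finset.univ.filter fun i => xd i ∈ Set.Ioc a b, Y i := by
  unfold ybar
  by_cases h : (nIv n xd a b : ℝ) = 0
  · have h' : (Finset.univ.filter fun i => xd i ∈ Set.Ioc a b) = ∅ :=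
      Finset.card_eq_zero.1 (Nat.cast_eq_zero.1 h)
    rw [h', h]
    simp
  · field_simp

theorem ybar_add (xd Y Z : Fin n → ℝ) (a b : ℝ) :
    ybar n xd (fun i => Y i + Z i) a b = ybar n xd Y a b + ybar n xd Z a b := by
  unfold ybar
  rw [Finset.sum_add_distrib, add_div]

/-- bias-variance decomposition of the sum of squares over a block -/
theorem blockSq_eq (xd Y : Fin n → ℝ) (a b c : ℝ) :
    blockSq xd Y a b c = blockSq xd Y a b (ybar n xd Y a b) +
      nIv n xd a b * (ybar n xd Y a b - c) ^ 2 := by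
  have h := ybar_mul_nIv xd Y a b
  set m := ybar n xd Y a b
  have h1 : ∀ d : ℝ, blockSq xd Y a b d =
      (∑ i ∈ Finset.univ.filter fun i => xd i ∈ Set.Ioc a b, Y i ^ 2) -
        2 * d * (nIv n xd a b * m) + nIv n xd a b * d ^ 2 := by
    intro d
    rw [h, Finset.mul_sum, blockSq, nIv, ← nsmul_eq_mul, ← Finset.sum_const,
      ← Finset.sum_sub_distrib, ← Finset.sum_add_distrib]
    exact Finset.sum_congr rfl fun i _ => by ring
  rw [h1 c, h1 m]
  ring

theorem blockSq_split (xd Y : Fin n → ℝ) {a m b : ℝ} (ham : a ≤ m) (hmb : m ≤ b) (c : ℝ) :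
    blockSq xd Y a b c = blockSq xd Y a m c + blockSq xd Y m b c := by
  unfold blockSq
  rw [← Finset.sum_union]
  · congr 1
    ext i
    simp only [Finset.mem_filter, Finset.mem_univ, true_and, Finset.mem_union, Set.mem_Ioc]
    constructor
    · rintro ⟨h1, h2⟩
      rcases le_or_gt (xd i) m with h | h
      · exact Or.inl ⟨h1, h⟩
      · exact Or.inr ⟨h, h2⟩
    · rintro (⟨h1, h2⟩ | ⟨h1, h2⟩)
      · exact ⟨h1, h2.trans hmb⟩
      · exact ⟨ham.trans_lt h1, h2⟩
  · rw [Finset.disjoint_filter]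
    rintro i - ⟨-, h1⟩ ⟨h2, -⟩
    exact not_lt.2 h1 h2

theorem abs_ybar_sub_le {xd Y : Fin n → ℝ} {a b y r : ℝ} (hn : 0 < nIv n xd a b)
    (h : ∀ i, xd i ∈ Set.Ioc a b → |Y i - y| ≤ r) : |ybar n xd Y a b - y| ≤ r := by
  have hn' : (0 : ℝ) < nIv n xd a b := Nat.cast_pos.2 hn
  have h1 : ybar n xd Y a b - y =
      (∑ i ∈ Finset.univ.filter fun i => xd i ∈ Set.Ioc a b, (Y i - y)) / nIv n xd a b := by
    rw [Finset.sum_sub_distrib, Finset.sum_const, nsmul_eq_mul, sub_div, ybar]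
    congr 1
    rw [eq_div_iff hn'.ne', mul_comm]
    rfl
  rw [h1, abs_div, abs_of_pos hn', div_le_iff₀ hn']
  refine (Finset.abs_sum_le_sum_abs _ _).trans ?_
  refine (Finset.sum_le_card_nsmul _ _ r fun i hi => h i (Finset.mem_filter.1 hi).2).trans ?_
  rw [nsmul_eq_mul, mul_comm, nIv]

theorem abs_ybar_le {xd Y : Fin n → ℝ} {a b r : ℝ} (hr : 0 ≤ r)
    (h : ∀ i, xd i ∈ Set.Ioc a b → |Y i| ≤ r) : |ybar n xd Y a b| ≤ r := by
  rcases Nat.eq_zero_or_pos (nIv n xd a b) with h0 | h0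
  · simpa [ybar, h0] using hr
  · simpa using abs_ybar_sub_le (y := 0) h0 (by simpa using h)

theorem blockMarg_integrable (xd Y : Fin n → ℝ) {g : ℝ → ℝ} (hg1 : ∫ β, g β = 1) (a b : ℝ) :
    Integrable fun β => g β * Real.exp (-(1 / 2 : ℝ) * blockSq xd Y a b β) := by
  have hi : Integrable g := by_contra fun h => zero_ne_one ((integral_undef h).symm.trans hg1)
  have hc := continuous_blockSq xd Y a b
  refine hi.mul_bdd (c := 1) (Continuous.aestronglyMeasurable (by fun_prop))
    (ae_of_all _ fun β => ?_)
  rw [Real.norm_eq_abs, Real.abs_exp, Real.exp_le_one_iff]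
  have : 0 ≤ blockSq xd Y a b β := Finset.sum_nonneg fun i _ => sq_nonneg _
  linarith

theorem blockMarg_nonneg (xd Y : Fin n → ℝ) {g : ℝ → ℝ} (hg0 : ∀ β, 0 ≤ g β) (a b : ℝ) :
    0 ≤ blockMarg xd Y g a b :=
  integral_nonneg fun β => mul_nonneg (hg0 β) (Real.exp_pos _).le

theorem blockMarg_le (xd Y : Fin n → ℝ) {g : ℝ → ℝ} (hg0 : ∀ β, 0 ≤ g β)
    (hg1 : ∫ β, g β = 1) (a b : ℝ) :
    blockMarg xd Y g a b ≤
      Real.exp (-(1 / 2 : ℝ) * blockSq xd Y a b (ybar n xd Y a b)) := by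
  have hi : Integrable g := by_contra fun h => zero_ne_one ((integral_undef h).symm.trans hg1)
  calc blockMarg xd Y g a b
      ≤ ∫ β, g β * Real.exp (-(1 / 2 : ℝ) * blockSq xd Y a b (ybar n xd Y a b)) := by
        refine integral_mono (blockMarg_integrable xd Y hg1 a b) (hi.mul_const _) fun β => ?_
        refine mul_le_mul_of_nonneg_left (Real.exp_le_exp.2 ?_) (hg0 β)
        rw [blockSq_eq xd Y a b β]
        have : 0 ≤ (nIv n xd a b : ℝ) * (ybar n xd Y a b - β) ^ 2 := by positivity
        linarith
    _ = _ := by rw [integral_mul_const, hg1, one_mul]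

/-- lower bound for the block marginal likelihood, when the block mean of the regression function
is at distance at least `r` from the boundary of `[-B₀, B₀]` and the noise is controlled by `v` -/
theorem le_blockMarg {xd Y : Fin n → ℝ} {g : ℝ → ℝ} (hg0 : ∀ β, 0 ≤ g β)
    (hg1 : ∫ β, g β = 1) {a b c₀ B₀ m r v : ℝ} (hgc : ∀ β, |β| ≤ B₀ → c₀ ≤ g β)
    (hr : 0 ≤ r) (hm : |m| + r ≤ B₀) (hnr : n * r ^ 2 ≤ 1)
    (hv : nIv n xd a b * (ybar n xd Y a b - m) ^ 2 ≤ v) :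
    c₀ * (2 * r) * Real.exp (-(1 + v)) *
        Real.exp (-(1 / 2 : ℝ) * blockSq xd Y a b (ybar n xd Y a b)) ≤
      blockMarg xd Y g a b := by
  have hi := blockMarg_integrable xd Y hg1 a b
  refine le_trans ?_ (setIntegral_le_integral (s := Set.Icc (m - r) (m + r)) hi
    (ae_of_all _ fun β => mul_nonneg (hg0 β) (Real.exp_pos _).le))
  have h := setIntegral_ge_of_const_le_real (μ := volume) (s := Set.Icc (m - r) (m + r))
    (c := c₀ * Real.exp (-(1 + v) - (1 / 2 : ℝ) * blockSq xd Y a b (ybar n xd Y a b)))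
    measurableSet_Icc (by simp) ?_ hi.integrableOn
  · refine le_trans (le_of_eq ?_) h
    rw [Real.volume_real_Icc_of_le (by linarith), sub_eq_add_neg (-(1 + v)), Real.exp_add]
    ring_nf
  · rintro β ⟨h1, h2⟩
    have hβ : |β - m| ≤ r := abs_le.2 ⟨by linarith, by linarith⟩
    have hβB : |β| ≤ B₀ := by
      have := abs_add_le (β - m) m
      rw [sub_add_cancel] at this
      linarith
    refine mul_le_mul (hgc β hβB) (Real.exp_le_exp.2 ?_) (Real.exp_pos _).le (hg0 β)
    rw [blockSq_eq xd Y a b β]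
    set w := ybar n xd Y a b
    have hnn : (nIv n xd a b : ℝ) ≤ n := by
      have := Finset.card_filter_le (Finset.univ : Finset (Fin n)) fun i => xd i ∈ Set.Ioc a b
      rw [Finset.card_univ, Fintype.card_fin] at this
      exact_mod_cast this
    have h3 : (nIv n xd a b : ℝ) * (β - m) ^ 2 ≤ 1 := by
      refine le_trans (mul_le_mul hnn ?_ (sq_nonneg _) (Nat.cast_nonneg _)) hnr
      rw [← sq_abs]
      exact pow_le_pow_left₀ (abs_nonneg _) hβ 2
    have h4 : (w - β) ^ 2 ≤ 2 * (w - m) ^ 2 + 2 * (β - m) ^ 2 := by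
      nlinarith [sq_nonneg ((w - m) + (β - m))]
    have h5 := mul_le_mul_of_nonneg_left h4 (Nat.cast_nonneg (α := ℝ) (nIv n xd a b))
    linarith

end Block

/-! ### Refining a partition around a point -/

section Refine

variable {n N : ℕ}

/-- the prior weight of a block times its marginal likelihood -/
def blockMass (z : Knot N → ℝ) (xd Y : Fin n → ℝ) (B : ℝ) (g : Knot N → ℝ → ℝ)
    (q : Knot N × Knot N) : ℝ :=
  (z q.2 - z q.1) ^ B * blockMarg xd Y (g q.2) (z q.1) (z q.2)

theorem partWeight_mul_integral {z : Knot N → ℝ} (hz : StrictMono z) {S : Finset (Knot N)}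
    (hS : IsPart N S) (xd Y : Fin n → ℝ) (B : ℝ) {g : Knot N → ℝ → ℝ} (hg0 : ∀ i b, 0 ≤ g i b)
    (hg1 : ∀ i, ∫ b, g i b = 1) :
    partWeight N z B S * ∫ β, Real.exp (partLoglik n N z xd Y S β) ∂partCondPrior N g S =
      Real.exp (-(1 / 2 : ℝ) * outerSq xd Y (z 0) (z (Fin.last N))) *
        ∏ q ∈ cells N S, blockMass z xd Y B g q := by
  rw [integral_exp_partLoglik hz hS xd Y hg0 hg1, partWeight, if_pos hS]
  simp only [blockMass, Finset.prod_mul_distrib, cells]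
  ring

theorem sum_le_of_card_fibre_le {α : Type*} [Fintype α] [DecidableEq α] {W : α → ℝ}
    (hW : ∀ T, 0 ≤ W T) {s : Finset α} {f : α → α} {ρ : ℝ} (hρ : 0 ≤ ρ) {k : ℕ}
    (h : ∀ S ∈ s, W S ≤ ρ * W (f S)) (hf : ∀ T, (s.filter fun S => f S = T).card ≤ k) :
    ∑ S ∈ s, W S ≤ k * ρ * ∑ T, W T := by
  calc ∑ S ∈ s, W S ≤ ∑ S ∈ s, ρ * W (f S) := Finset.sum_le_sum h
    _ = ∑ T, ∑ S ∈ s.filter fun S => f S = T, ρ * W (f S) := (Finset.sum_fiberwise s f _).symm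
    _ ≤ ∑ T, k * ρ * W T := by
        refine Finset.sum_le_sum fun T _ => ?_
        rw [Finset.sum_congr rfl (g := fun _ => ρ * W T)
          fun S hS => by rw [(Finset.mem_filter.1 hS).2], Finset.sum_const, nsmul_eq_mul, mul_assoc]
        exact mul_le_mul_of_nonneg_right (Nat.cast_le.2 (hf T)) (mul_nonneg hρ (hW T))
    _ = _ := by rw [Finset.mul_sum]

theorem partPost_le_of_refine {z : Knot N → ℝ} (hz : StrictMono z) (xd Y : Fin n → ℝ) (B : ℝ)
    {g : Knot N → ℝ → ℝ} (hg0 : ∀ i b, 0 ≤ g i b) (hg1 : ∀ i, ∫ b, g i b = 1)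
    (A : Finset (Knot N) → Prop) (i₀ j₀ : Knot N) {ρ : ℝ} (hρ : 0 ≤ ρ)
    (h : ∀ S, IsPart N S → A S → ∃ T, IsPart N T ∧
      S ∈ ({T, T.erase i₀, T.erase j₀, (T.erase j₀).erase i₀} : Finset (Finset (Knot N))) ∧
      ∏ q ∈ cells N S, blockMass z xd Y B g q ≤ ρ * ∏ q ∈ cells N T, blockMass z xd Y B g q) :
    0 ≤ partPost n N z xd B g Y (fun S _ => A S) ∧
      partPost n N z xd B g Y (fun S _ => A S) ≤ 4 * ρ := by
  set W : Finset (Knot N) → ℝ := fun S => partWeight N z B S *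
    ∫ β, Real.exp (partLoglik n N z xd Y S β) ∂partCondPrior N g S with hWdef
  have hW : ∀ S, 0 ≤ W S := by
    intro S
    refine mul_nonneg ?_ (integral_nonneg fun β => (Real.exp_pos _).le)
    unfold partWeight
    split_ifs
    · refine Finset.prod_nonneg fun q hq => Real.rpow_nonneg ?_ _
      exact sub_nonneg.2 (hz (mem_cells.1 hq).2.2.1).le
    · exact le_rfl
  set s : Finset (Finset (Knot N)) := Finset.univ.filter fun S => A S ∧ IsPart N S with hs
  have hnum : (∑ S : Finset (Knot N), partWeight N z B S *
      ∫ β, (if A S then (1 : ℝ) else 0) * Real.exp (partLoglik n N z xd Y S β)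
        ∂partCondPrior N g S) = ∑ S ∈ s, W S := by
    rw [hs, Finset.sum_filter]
    refine Finset.sum_congr rfl fun S _ => ?_
    by_cases hA : A S <;> by_cases hP : IsPart N S <;> simp [hA, hP, hWdef, partWeight]
  have hpost : partPost n N z xd B g Y (fun S _ => A S) = (∑ S ∈ s, W S) / ∑ S, W S := by
    rw [← hnum]
    rfl
  rw [hpost]
  have hsum : 0 ≤ ∑ S, W S := Finset.sum_nonneg fun S _ => hW S
  refine ⟨div_nonneg (Finset.sum_nonneg fun S _ => hW S) hsum,
    div_le_of_le_mul₀ hsum (by positivity) ?_⟩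
  have h' : ∀ S, ∃ T, S ∈ s →
      S ∈ ({T, T.erase i₀, T.erase j₀, (T.erase j₀).erase i₀} : Finset (Finset (Knot N))) ∧
      W S ≤ ρ * W T := by
    intro S
    by_cases hS : S ∈ s
    · obtain ⟨hA, hP⟩ := (Finset.mem_filter.1 hS).2
      obtain ⟨T, hT, hm, hle⟩ := h S hP hA
      refine ⟨T, fun _ => ⟨hm, ?_⟩⟩
      simp only [hWdef]
      rw [partWeight_mul_integral hz hP xd Y B hg0 hg1, partWeight_mul_integral hz hT xd Y B hg0 hg1]
      have := mul_le_mul_of_nonneg_left hle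
        (Real.exp_pos (-(1 / 2 : ℝ) * outerSq xd Y (z 0) (z (Fin.last N)))).le
      linarith
    · exact ⟨S, fun h => absurd h hS⟩
  choose f hf using h'
  refine (sum_le_of_card_fibre_le (k := 4) hW hρ (fun S hS => (hf S hS).2) fun T => ?_).trans
    (le_of_eq (by norm_num))
  refine (Finset.card_le_card (t :=
    ({T, T.erase i₀, T.erase j₀, (T.erase j₀).erase i₀} : Finset (Finset (Knot N)))) ?_).trans
    Finset.card_le_four
  intro S hS
  obtain ⟨hSs, hfS⟩ := Finset.mem_filter.1 hS
  rw [← hfS]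
  exact (hf S hSs).1

theorem exists_refine {z : Knot N → ℝ} (hz : StrictMono z) {xd Y : Fin n → ℝ} {B lam : ℝ}
    {g : Knot N → ℝ → ℝ} (hlam : 0 < lam) (hlam1 : lam ≤ 1)
    (hup : ∀ i j, i < j → blockMass z xd Y B g (i, j) ≤
      Real.exp (-(1 / 2 : ℝ) * blockSq xd Y (z i) (z j) (ybar n xd Y (z i) (z j))))
    (hlow : ∀ i j, i < j → lam *
      Real.exp (-(1 / 2 : ℝ) * blockSq xd Y (z i) (z j) (ybar n xd Y (z i) (z j))) ≤
        blockMass z xd Y B g (i, j))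
    {S : Finset (Knot N)} (hS : IsPart N S) {i j i₀ j₀ : Knot N} (hij : Consec N S i j)
    (h00 : i₀ < j₀) (hi₀ : i₀ < j) (hj₀ : i < j₀) (hor : i < i₀ ∨ j₀ < j) {D : ℝ}
    (hD : D ≤ nIv n xd (z (max i i₀)) (z (min j j₀)) *
      (ybar n xd Y (z (max i i₀)) (z (min j j₀)) - ybar n xd Y (z i) (z j)) ^ 2) :
    ∃ T, IsPart N T ∧
      S ∈ ({T, T.erase i₀, T.erase j₀, (T.erase j₀).erase i₀} : Finset (Finset (Knot N))) ∧
      lam ^ 3 * Real.exp (D / 2) * ∏ q ∈ cells N S, blockMass z xd Y B g q ≤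
        ∏ q ∈ cells N T, blockMass z xd Y B g q := by
  set φ := blockMass z xd Y B g
  set c := ybar n xd Y (z i) (z j)
  have hpos : ∀ k l, k < l → 0 < φ (k, l) := fun k l hkl =>
    (mul_pos hlam (Real.exp_pos _)).trans_le (hlow k l hkl)
  have hPpos : ∀ T : Finset (Knot N), 0 ≤ ∏ q ∈ cells N T, φ q := fun T =>
    Finset.prod_nonneg fun q hq => (hpos q.1 q.2 (mem_cells.1 hq).2.2.1).le
  have hlowc : ∀ k l, k < l → lam * Real.exp (-(1 / 2 : ℝ) * blockSq xd Y (z k) (z l) c) ≤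
      φ (k, l) := by
    intro k l hkl
    refine (mul_le_mul_of_nonneg_left (Real.exp_le_exp.2 ?_) hlam.le).trans (hlow k l hkl)
    rw [blockSq_eq xd Y (z k) (z l) c]
    have : 0 ≤ (nIv n xd (z k) (z l) : ℝ) * (ybar n xd Y (z k) (z l) - c) ^ 2 := by positivity
    linarith
  have hgain : ∀ k l, k < l → D ≤ nIv n xd (z k) (z l) * (ybar n xd Y (z k) (z l) - c) ^ 2 →
      lam * Real.exp (-(1 / 2 : ℝ) * blockSq xd Y (z k) (z l) c + D / 2) ≤ φ (k, l) := by
    intro k l hkl hDkl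
    refine (mul_le_mul_of_nonneg_left (Real.exp_le_exp.2 ?_) hlam.le).trans (hlow k l hkl)
    rw [blockSq_eq xd Y (z k) (z l) c]
    linarith
  have hupij := hup i j hij.2.2.1
  have hm : ∀ k l, k < l → z k ≤ z l := fun k l hkl => (hz hkl).le
  by_cases h1 : i < i₀
  · have hi₀S : i₀ ∉ S := fun h => hij.2.2.2 _ h ⟨h1, hi₀⟩
    have e1 := hij.prod_cells_insert h1 hi₀ φ
    rw [max_eq_right h1.le] at hD
    by_cases h2 : j₀ < j
    · have hj₀S : j₀ ∉ insert i₀ S := fun h =>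
        (hij.insert_right h1 hi₀).2.2.2 _ h ⟨h00, h2⟩
      have e2 := (hij.insert_right h1 hi₀).prod_cells_insert h00 h2 φ
      rw [min_eq_right h2.le] at hD
      refine ⟨insert j₀ (insert i₀ S), (hS.insert i₀).insert j₀, ?_, ?_⟩
      · simp [Finset.erase_insert hj₀S, Finset.erase_insert hi₀S]
      · have hkey : lam ^ 3 * Real.exp (D / 2) * φ (i, j) ≤
            φ (i, i₀) * φ (i₀, j₀) * φ (j₀, j) := by
          calc lam ^ 3 * Real.exp (D / 2) * φ (i, j)
              ≤ lam ^ 3 * Real.exp (D / 2) *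
                Real.exp (-(1 / 2 : ℝ) * blockSq xd Y (z i) (z j) c) :=
                mul_le_mul_of_nonneg_left hupij (by positivity)
            _ = (lam * Real.exp (-(1 / 2 : ℝ) * blockSq xd Y (z i) (z i₀) c)) *
                (lam * Real.exp (-(1 / 2 : ℝ) * blockSq xd Y (z i₀) (z j₀) c + D / 2)) *
                (lam * Real.exp (-(1 / 2 : ℝ) * blockSq xd Y (z j₀) (z j) c)) := by
                rw [blockSq_split xd Y (hm _ _ h1) (hm _ _ hi₀),
                  blockSq_split xd Y (hm _ _ h00) (hm _ _ h2), mul_add, mul_add, Real.exp_add,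
                  Real.exp_add, Real.exp_add]
                ring
            _ ≤ _ := by
                have := hpos _ _ h1
                have := hpos _ _ h00
                gcongr
                · exact hlowc _ _ h1
                · exact hgain _ _ h00 hD
                · exact hlowc _ _ h2
        have hp := hpos _ _ hij.2.2.1
        have hp' := hpos _ _ hi₀
        refine le_of_mul_le_mul_right ?_ (mul_pos hp hp')
        calc _ = (lam ^ 3 * Real.exp (D / 2) * φ (i, j)) *
              ((∏ q ∈ cells N S, φ q) * φ (i₀, j)) := by ring
          _ ≤ (φ (i, i₀) * φ (i₀, j₀) * φ (j₀, j)) * ((∏ q ∈ cells N S, φ q) * φ (i₀, j)) :=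
              mul_le_mul_of_nonneg_right hkey (mul_nonneg (hPpos S) hp'.le)
          _ = (∏ q ∈ cells N S, φ q) * (φ (i, i₀) * φ (i₀, j)) * (φ (i₀, j₀) * φ (j₀, j)) := by
              ring
          _ = ((∏ q ∈ cells N (insert i₀ S), φ q) * (φ (i₀, j₀) * φ (j₀, j))) * φ (i, j) := by
              rw [← e1]; ring
          _ = _ := by rw [← e2]; ring
    · rw [min_eq_left (not_lt.1 h2)] at hD
      refine ⟨insert i₀ S, hS.insert i₀, ?_, ?_⟩
      · simp [Finset.erase_insert hi₀S]
      · refine le_of_mul_le_mul_right ?_ (hpos _ _ hij.2.2.1)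
        rw [e1, mul_comm _ (∏ q ∈ cells N S, φ q), mul_assoc]
        refine mul_le_mul_of_nonneg_left ?_ (hPpos S)
        calc lam ^ 3 * Real.exp (D / 2) * φ (i, j)
            ≤ lam ^ 2 * Real.exp (D / 2) *
              Real.exp (-(1 / 2 : ℝ) * blockSq xd Y (z i) (z j) c) := by
              have : lam ^ 3 ≤ lam ^ 2 := pow_le_pow_of_le_one hlam.le hlam1 (by norm_num)
              have := hpos _ _ hij.2.2.1
              gcongr
          _ = (lam * Real.exp (-(1 / 2 : ℝ) * blockSq xd Y (z i) (z i₀) c)) *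
              (lam * Real.exp (-(1 / 2 : ℝ) * blockSq xd Y (z i₀) (z j) c + D / 2)) := by
              rw [blockSq_split xd Y (hm _ _ h1) (hm _ _ hi₀), mul_add, Real.exp_add, Real.exp_add]
              ring
          _ ≤ _ := by
              have := hpos _ _ h1
              gcongr
              · exact hlowc _ _ h1
              · exact hgain _ _ hi₀ hD
  · have h2 : j₀ < j := hor.resolve_left h1
    have hj₀S : j₀ ∉ S := fun h => hij.2.2.2 _ h ⟨hj₀, h2⟩
    have e1 := hij.prod_cells_insert hj₀ h2 φ
    rw [max_eq_left (not_lt.1 h1), min_eq_right h2.le] at hD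
    refine ⟨insert j₀ S, hS.insert j₀, ?_, ?_⟩
    · simp [Finset.erase_insert hj₀S]
    · refine le_of_mul_le_mul_right ?_ (hpos _ _ hij.2.2.1)
      rw [e1, mul_comm _ (∏ q ∈ cells N S, φ q), mul_assoc]
      refine mul_le_mul_of_nonneg_left ?_ (hPpos S)
      calc lam ^ 3 * Real.exp (D / 2) * φ (i, j)
          ≤ lam ^ 2 * Real.exp (D / 2) *
            Real.exp (-(1 / 2 : ℝ) * blockSq xd Y (z i) (z j) c) := by
            have : lam ^ 3 ≤ lam ^ 2 := pow_le_pow_of_le_one hlam.le hlam1 (by norm_num)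
            have := hpos _ _ hij.2.2.1
            gcongr
        _ = (lam * Real.exp (-(1 / 2 : ℝ) * blockSq xd Y (z i) (z j₀) c + D / 2)) *
            (lam * Real.exp (-(1 / 2 : ℝ) * blockSq xd Y (z j₀) (z j) c)) := by
            rw [blockSq_split xd Y (hm _ _ hj₀) (hm _ _ h2), mul_add, Real.exp_add, Real.exp_add]
            ring
        _ ≤ _ := by
            have := hpos _ _ hj₀
            gcongr
            · exact hgain _ _ hj₀ hD
            · exact hlowc _ _ h2

end Refine

/-! ### The posterior bound for a fixed sample size -/

section FixedSample

variable {n N : ℕ} {z : Knot N → ℝ} {C₁ C₂ : ℝ}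

theorem IsGrid.strictMono (h : IsGrid n N z C₁ C₂) (h0 : 0 < C₁ * Real.log n / n) :
    StrictMono z :=
  Fin.strictMono_iff_lt_succ.2 fun k => by linarith [(h.2.2 k).1]

theorem IsGrid.le_sub (h : IsGrid n N z C₁ C₂) (h0 : 0 < C₁ * Real.log n / n) {i j : Knot N}
    (hij : i < j) : C₁ * Real.log n / n ≤ z j - z i := by
  obtain ⟨k, rfl⟩ := Fin.exists_castSucc_eq.2 (hij.trans_le (Fin.le_last j)).ne
  have := (h.strictMono h0).monotone (Fin.castSucc_lt_iff_succ_le.1 hij)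
  linarith [(h.2.2 k).1]

theorem IsGrid.exists_bracket (h : IsGrid n N z C₁ C₂) (h0 : 0 < C₁ * Real.log n / n) {y : ℝ}
    (hy : y ∈ Set.Ioc (0 : ℝ) 1) :
    ∃ i j, y ∈ Set.Ioc (z i) (z j) ∧ z j - z i ≤ C₂ * Real.log n / n := by
  obtain ⟨i, j, hij, hyij⟩ := exists_consec_mem (S := Finset.univ) (h.strictMono h0)
    ⟨Finset.mem_univ _, Finset.mem_univ _⟩ (y := y) (by rwa [h.1, h.2.1])
  refine ⟨i, j, hyij, ?_⟩
  obtain ⟨k, rfl⟩ := Fin.exists_castSucc_eq.2 (hij.2.2.1.trans_le (Fin.le_last j)).ne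
  have hle : j ≤ k.succ := not_lt.1 fun hlt =>
    hij.2.2.2 k.succ (Finset.mem_univ _) ⟨Fin.castSucc_lt_succ, hlt⟩
  have := (h.strictMono h0).monotone hle
  linarith [(h.2.2 k).2]

theorem mul_sq_le_of_abs_le_sqrt {k w u L : ℝ} (hk : 0 ≤ k) (hL : 0 ≤ L)
    (h : |w| ≤ u * Real.sqrt (L / k)) : k * w ^ 2 ≤ u ^ 2 * L := by
  rcases hk.eq_or_lt with rfl | hk
  · rw [zero_mul]
    positivity
  · calc k * w ^ 2 = k * |w| ^ 2 := by rw [sq_abs]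
      _ ≤ k * (u * Real.sqrt (L / k)) ^ 2 := by gcongr
      _ = u ^ 2 * L := by
          rw [mul_pow, Real.sq_sqrt (by positivity)]
          field_simp

theorem abs_le_of_abs_le_sqrt {k w u L κ e : ℝ} (hκ : 0 < κ) (he : 0 < e) (hu : 0 ≤ u)
    (hk : κ * L / e ^ 2 ≤ k) (hL : 0 < L) (h : |w| ≤ u * Real.sqrt (L / k)) :
    |w| ≤ u / Real.sqrt κ * e := by
  refine h.trans ?_
  rw [div_mul_eq_mul_div, mul_div_assoc]
  refine mul_le_mul_of_nonneg_left ?_ hu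
  rw [Real.sqrt_le_left (by positivity), div_pow, Real.sq_sqrt hκ.le]
  have hk0 : 0 < k := lt_of_lt_of_le (by positivity) hk
  rw [div_le_div_iff₀ hk0 hκ]
  rw [div_le_iff₀ (by positivity)] at hk
  linarith

theorem posterior_le
    {t M η : ℝ → ℝ} {f₀ : ℝ → ℝ} {x b B B₀ c₀ c₁ p₀ p₁ u₀ u₁ u₂ δ M₁ h r lam : ℝ}
    {xd : Fin n → ℝ} {g : Knot N → ℝ → ℝ} {pI : ℝ → ℝ → ℝ} {ε : Fin n → ℝ}
    (hx : x ∈ Set.Ioo (0 : ℝ) 1) (hB : 0 ≤ B) (hC₁ : 0 < C₁)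
    (hc₀ : 0 < c₀) (hp₀ : 0 < p₀) (htx : 0 < t x) (hMx : 0 ≤ M x)
    (hf₀ : HolderAt f₀ (t x) (M x) (η x) x) (hf₀b : ∀ y ∈ Set.Icc (0 : ℝ) 1, |f₀ y| ≤ b)
    (hgrid : IsGrid n N z C₁ C₂) (hdens : GoodDens N g c₀ c₁ B₀)
    (hpI : ∀ a b : ℝ, a ≤ b → p₀ * (b - a) ≤ pI a b ∧ pI a b ≤ p₁ * (b - a))
    (hu₀ : 0 < u₀) (hδ : 0 < δ)
    (hX : OmegaX n N xd z pI u₁ x) (hY : OmegaY n N xd z u₀ x ε) (hY2 : OmegaY2 n N xd z u₂ x ε)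
    (hn : 0 < n) (hL : 0 < Real.log n) (he : 0 < epsn t n x) (hh : 0 < h)
    (hnh : n * h * epsn t n x ^ 2 = Real.log n) (hht : h ^ t x = epsn t n x)
    (hsp : C₂ * Real.log n / n ≤ h / 2) (hhη : h ≤ η x) (hhx : h < x) (hxh : x + h < 1)
    (hue : 8 * u₁ ^ 2 * epsn t n x ^ 2 ≤ p₀)
    (hr : 0 ≤ r) (hbr : b + r ≤ B₀) (hnr : n * r ^ 2 ≤ 1) (hlam : 0 < lam) (hlam1 : lam ≤ 1)
    (hlamle : lam ≤ (C₁ * Real.log n / n) ^ B *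
      (c₀ * (2 * r) * Real.exp (-(1 + u₂ ^ 2 * Real.log n))))
    (hM₁ : 2 * (M x + u₀ / Real.sqrt (p₀ / 4)) ≤ M₁) (hM₁' : 2 * M x ≤ M₁)
    (hM₁δ : 2 * u₀ / Real.sqrt δ < M₁) :
    0 ≤ partPost n N z xd B g (fun i => f₀ (xd i) + ε i)
        (fun S _ => M₁ * epsn t n x < |ybarIx n N xd z (fun i => f₀ (xd i) + ε i) S x - f₀ x| ∧
          snD t n x δ < nIx n N xd z S x) ∧
      partPost n N z xd B g (fun i => f₀ (xd i) + ε i)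
        (fun S _ => M₁ * epsn t n x < |ybarIx n N xd z (fun i => f₀ (xd i) + ε i) S x - f₀ x| ∧
          snD t n x δ < nIx n N xd z S x) ≤
        4 * ((lam ^ 3)⁻¹ * Real.exp (-(p₀ * M₁ ^ 2 * Real.log n / 32))) := by
  have hn' : (0 : ℝ) < n := Nat.cast_pos.2 hn
  have hlo : 0 < C₁ * Real.log n / n := by positivity
  have hz := hgrid.strictMono hlo
  obtain ⟨hx0, hx1⟩ := hx
  set e := epsn t n x with he_def
  set L := Real.log n with hL_def
  set Y : Fin n → ℝ := fun i => f₀ (xd i) + ε i with hYdef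
  have hxz : x ∈ Set.Ioc (z 0) (z (Fin.last N)) := by
    rw [hgrid.1, hgrid.2.1]
    exact ⟨hx0, hx1.le⟩
  have hz0 : ∀ i, 0 ≤ z i := fun i => hgrid.1 ▸ hz.monotone (Fin.zero_le i)
  have hz1 : ∀ i, z i ≤ 1 := fun i => hgrid.2.1 ▸ hz.monotone (Fin.le_last i)
  have hg0 : ∀ i β, 0 ≤ g i β := fun i => (hdens i).2.1
  have hg1 : ∀ i, ∫ β, g i β = 1 := fun i => (hdens i).2.2.2
  have hup : ∀ i j, i < j → blockMass z xd Y B g (i, j) ≤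
      Real.exp (-(1 / 2 : ℝ) * blockSq xd Y (z i) (z j) (ybar n xd Y (z i) (z j))) := by
    intro i j hij
    have h1 := hz hij
    refine (mul_le_of_le_one_left (blockMarg_nonneg xd Y (hg0 j) _ _) ?_).trans
      (blockMarg_le xd Y (hg0 j) (hg1 j) _ _)
    exact Real.rpow_le_one (by simpa using h1.le) (by linarith [hz0 i, hz1 j]) hB
  have hlow : ∀ i j, i < j → lam *
      Real.exp (-(1 / 2 : ℝ) * blockSq xd Y (z i) (z j) (ybar n xd Y (z i) (z j))) ≤
        blockMass z xd Y B g (i, j) := by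
    intro i j hij
    have hm : |ybar n xd (fun k => f₀ (xd k)) (z i) (z j)| ≤ b := by
      refine abs_ybar_le ((abs_nonneg _).trans (hf₀b 0 ⟨le_rfl, zero_le_one⟩)) fun k hk => ?_
      exact hf₀b _ ⟨(hz0 i).trans hk.1.le, hk.2.trans (hz1 j)⟩
    have hv : (nIv n xd (z i) (z j) : ℝ) *
        (ybar n xd Y (z i) (z j) - ybar n xd (fun k => f₀ (xd k)) (z i) (z j)) ^ 2 ≤
          u₂ ^ 2 * L := by
      rw [hYdef, ybar_add, add_sub_cancel_left]
      exact mul_sq_le_of_abs_le_sqrt (Nat.cast_nonneg _) hL.le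
        (hY2 (i, j) (mem_IcalPairs hxz hij))
    have h1 := le_blockMarg (hg0 j) (hg1 j) (hdens j).1 hr (by linarith) hnr hv
    calc _ ≤ (C₁ * L / n) ^ B * (c₀ * (2 * r) * Real.exp (-(1 + u₂ ^ 2 * L))) *
          Real.exp (-(1 / 2 : ℝ) * blockSq xd Y (z i) (z j) (ybar n xd Y (z i) (z j))) :=
          mul_le_mul_of_nonneg_right hlamle (Real.exp_pos _).le
      _ = (C₁ * L / n) ^ B * (c₀ * (2 * r) * Real.exp (-(1 + u₂ ^ 2 * L)) *
          Real.exp (-(1 / 2 : ℝ) * blockSq xd Y (z i) (z j) (ybar n xd Y (z i) (z j)))) := by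
          ring
      _ ≤ _ := by
          refine mul_le_mul (Real.rpow_le_rpow hlo.le (hgrid.le_sub hlo hij) hB) h1
            (by positivity) (Real.rpow_nonneg (sub_nonneg.2 (hz hij).le) _)
  -- the observations of any block around `x` within distance `h` have mean close to `f₀ x`
  have hbias : ∀ i j, i < j → x ∈ Set.Ioc (z i) (z j) → x - h ≤ z i → z j ≤ x + h →
      ∀ κ, 0 < κ → κ * L / e ^ 2 ≤ nIv n xd (z i) (z j) →
        |ybar n xd Y (z i) (z j) - f₀ x| ≤ (M x + u₀ / Real.sqrt κ) * e := by
    intro i j hij hxij hi hj κ hκ hnum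
    have hnpos : 0 < nIv n xd (z i) (z j) :=
      Nat.cast_pos.1 (lt_of_lt_of_le (by positivity) hnum)
    have h1 : |ybar n xd (fun k => f₀ (xd k)) (z i) (z j) - f₀ x| ≤ M x * e := by
      refine abs_ybar_sub_le hnpos fun k hk => ?_
      have hkh : |xd k - x| ≤ h := abs_le.2 ⟨by linarith [hk.1], by linarith [hk.2]⟩
      by_cases hkx : xd k - x = 0
      · rw [sub_eq_zero.1 hkx, sub_self, abs_zero]
        positivity
      · have h2 := hf₀.2 (xd k - x) hkx (hkh.trans hhη)
          ⟨by linarith [hk.1, hz0 i], by linarith [hk.2, hz1 j]⟩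
        rw [add_sub_cancel] at h2
        refine h2.trans (mul_le_mul_of_nonneg_left ?_ hMx)
        rw [← hht]
        exact Real.rpow_le_rpow (abs_nonneg _) hkh htx.le
    have h2 := abs_le_of_abs_le_sqrt hκ he hu₀.le hnum hL (hY (i, j) (mem_IxPairs hij hxij))
    rw [hYdef, ybar_add, add_sub_right_comm]
    refine (abs_add_le _ _).trans ?_
    rw [add_mul]
    exact add_le_add h1 h2
  obtain ⟨k₁, i₀, ⟨hi₀l, hi₀r⟩, hi₀s⟩ :=
    hgrid.exists_bracket hlo (y := x - h) ⟨by linarith, by linarith⟩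
  obtain ⟨j₀, k₂, ⟨hj₀l, hj₀r⟩, hj₀s⟩ :=
    hgrid.exists_bracket hlo (y := x + h) ⟨by linarith, by linarith⟩
  have hi₀x : z i₀ ≤ x - h / 2 := by linarith
  have hj₀x : x + h / 2 ≤ z j₀ := by linarith
  have h00 : i₀ < j₀ := hz.lt_iff_lt.1 (by linarith)
  refine partPost_le_of_refine hz xd Y B hg0 hg1 _ i₀ j₀ (by positivity) ?_
  rintro S hS ⟨hA1, hA2⟩
  obtain ⟨i, j, hij, hxij⟩ := exists_consec_mem hz hS hxz
  have hybar : ybarIx n N xd z Y S x = ybar n xd Y (z i) (z j) :=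
    sum_ite_consec hz hij hxij fun k l => ybar n xd Y (z k) (z l)
  have hnIx : nIx n N xd z S x = nIv n xd (z i) (z j) :=
    sum_ite_consec hz hij hxij fun k l => (nIv n xd (z k) (z l) : ℝ)
  rw [hybar] at hA1
  rw [hnIx, snD] at hA2
  have hi₀j : i₀ < j := hz.lt_iff_lt.1 (by linarith [hxij.2])
  have hij₀ : i < j₀ := hz.lt_iff_lt.1 (by linarith [hxij.1])
  have hor : i < i₀ ∨ j₀ < j := by
    by_contra hc
    rw [not_or, not_lt, not_lt] at hc
    have h1 := hz.monotone hc.1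
    have h2 := hz.monotone hc.2
    have h3 := hbias i j hij.2.2.1 hxij (by linarith) (by linarith) δ hδ hA2.le
    have h4 : (M x + u₀ / Real.sqrt δ) ≤ M₁ := by
      rw [mul_div_assoc] at hM₁δ
      linarith
    exact absurd (hA1.trans_le h3) (not_lt.2 (mul_le_mul_of_nonneg_right h4 he.le))
  set i' := max i i₀ with hi'
  set j' := min j j₀ with hj'
  have hzi' : z i' = max (z i) (z i₀) := hz.monotone.map_max
  have hzj' : z j' = min (z j) (z j₀) := hz.monotone.map_min
  have hxi' : z i' < x := by
    rw [hzi']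
    exact max_lt hxij.1 (by linarith)
  have hxj' : x ≤ z j' := by
    rw [hzj']
    exact le_min hxij.2 (by linarith)
  have hij' : i' < j' := hz.lt_iff_lt.1 (hxi'.trans_le hxj')
  have hlen : h / 2 ≤ z j' - z i' := by
    rcases hor with h1 | h1
    · have : i' = i₀ := max_eq_right h1.le
      rw [this]
      linarith
    · have : j' = j₀ := min_eq_right h1.le
      rw [this]
      linarith
  have hcount : p₀ / 4 * L / e ^ 2 ≤ nIv n xd (z i') (z j') := by
    have h1 := hX (i', j') (mem_IcalPairs hxz hij')
    simp only at h1
    have h2 := (hpI (z i') (z j') (hz hij').le).1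
    set P := n * pI (z i') (z j') with hP
    have hnh' : n * h = L / e ^ 2 := by
      rw [eq_div_iff (by positivity)]
      exact hnh
    have h3 : p₀ / 2 * (L / e ^ 2) ≤ P := by
      rw [← hnh', hP]
      have := mul_le_mul_of_nonneg_left hlen hp₀.le
      have := mul_le_mul_of_nonneg_left (this.trans h2) hn'.le
      linarith
    have hP0 : 0 < P := lt_of_lt_of_le (by positivity) h3
    have h4 : 4 * u₁ ^ 2 * L ≤ P := by
      refine le_trans ?_ h3
      rw [mul_div_assoc', le_div_iff₀ (by positivity)]
      have := mul_le_mul_of_nonneg_right hue hL.le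
      linarith
    have h5 : u₁ * Real.sqrt (L * P) ≤ P / 2 := by
      refine le_of_sq_le_sq ?_ (by positivity)
      rw [mul_pow, Real.sq_sqrt (by positivity)]
      have := mul_le_mul_of_nonneg_right h4 hP0.le
      linarith
    have h6 := (abs_le.1 (h1.trans h5)).1
    have h7 : p₀ / 4 * L / e ^ 2 = p₀ / 2 * (L / e ^ 2) / 2 := by ring
    rw [h7]
    linarith
  have hmean := hbias i' j' hij' ⟨hxi', hxj'⟩ (by rw [hzi']; exact le_max_of_le_right hi₀r)
    (by rw [hzj']; exact (min_le_right _ _).trans hj₀l.le) (p₀ / 4) (by positivity) hcount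
  have hM₁0 : 0 < M₁ := lt_of_le_of_lt (by positivity) hM₁δ
  have hdiff : M₁ / 2 * e ≤ |ybar n xd Y (z i') (z j') - ybar n xd Y (z i) (z j)| := by
    have h1 := hmean.trans (mul_le_mul_of_nonneg_right
      (show M x + u₀ / Real.sqrt (p₀ / 4) ≤ M₁ / 2 by linarith) he.le)
    have h2 := abs_sub_abs_le_abs_sub (ybar n xd Y (z i) (z j) - f₀ x)
      (ybar n xd Y (z i') (z j') - f₀ x)
    rw [sub_sub_sub_cancel_right,
      abs_sub_comm (ybar n xd Y (z i) (z j)) (ybar n xd Y (z i') (z j'))] at h2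
    linarith
  have hD : p₀ * M₁ ^ 2 * L / 16 ≤ nIv n xd (z i') (z j') *
      (ybar n xd Y (z i') (z j') - ybar n xd Y (z i) (z j)) ^ 2 := by
    rw [← sq_abs (_ - _)]
    calc p₀ * M₁ ^ 2 * L / 16 = p₀ / 4 * L / e ^ 2 * (M₁ / 2 * e) ^ 2 := by
          field_simp
          ring
      _ ≤ _ := by gcongr
  obtain ⟨T, hT, hmem, hle⟩ :=
    exists_refine hz hlam hlam1 hup hlow hS hij h00 hi₀j hij₀ hor hD
  refine ⟨T, hT, hmem, ?_⟩
  rw [Real.exp_neg, ← mul_inv, inv_mul_eq_div, le_div_iff₀ (by positivity), mul_comm]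
  convert! hle using 3
  ring_nf

end FixedSample

/-! ### Asymptotics of the local rate -/

section Rates

theorem tendsto_div_log_atTop :
    Tendsto (fun n : ℕ => (n : ℝ) / Real.log n) atTop atTop := by
  have h1 : Tendsto (fun y : ℝ => Real.log y / y) atTop (nhdsWithin 0 (Set.Ioi 0)) := by
    refine tendsto_nhdsWithin_iff.2 ⟨?_, ?_⟩
    · simpa using Real.tendsto_pow_log_div_mul_add_atTop 1 0 1 one_ne_zero
    · filter_upwards [eventually_gt_atTop (1 : ℝ)] with y hy
      exact div_pos (Real.log_pos hy) (zero_lt_one.trans hy)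
  have h2 := h1.inv_tendsto_nhdsGT_zero.comp tendsto_natCast_atTop_atTop
  refine h2.congr fun n => ?_
  simp

theorem tendsto_rpow_neg_div_log {s : ℝ} (hs : 0 < s) :
    Tendsto (fun n : ℕ => ((n : ℝ) / Real.log n) ^ (-s)) atTop (nhds 0) :=
  (tendsto_rpow_neg_atTop hs).comp tendsto_div_log_atTop

/-- the negative power of `n` is eventually below the normalising constants of a block -/
theorem eventually_rpow_le {B C₁ c w : ℝ} (hB : 0 ≤ B) (hC₁ : 0 < C₁) (hc : 0 < c) :
    ∀ᶠ n : ℕ in atTop, (n : ℝ) ^ (-(2 * B + 2 + w)) ≤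
      (C₁ * Real.log n / n) ^ B * (c / n * Real.exp (-(1 + w * Real.log n))) := by
  have hlog := (Real.tendsto_log_atTop.comp tendsto_natCast_atTop_atTop).eventually_ge_atTop
    (1 : ℝ)
  have hbig := fun y : ℝ =>
    (tendsto_natCast_atTop_atTop (R := ℝ)).eventually_ge_atTop y
  filter_upwards [hlog, hbig 1, hbig (1 / C₁), hbig (Real.exp 1 / c)] with n h1 h2 h3 h4
  have hn : (0 : ℝ) < n := by linarith
  simp only [Function.comp_apply] at h1
  have e1 : (n : ℝ) ^ (-(2 * B)) ≤ (C₁ * Real.log n / n) ^ B := by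
    have : ((n : ℝ) ^ (-(2 * B))) = ((n : ℝ) ^ (-2 : ℝ)) ^ B := by
      rw [← Real.rpow_mul hn.le]
      ring_nf
    rw [this]
    refine Real.rpow_le_rpow (by positivity) ?_ hB
    rw [Real.rpow_neg hn.le, Real.rpow_two, le_div_iff₀ hn]
    rw [div_le_iff₀ hC₁] at h3
    have e2 : ((n : ℝ) ^ 2)⁻¹ * n = 1 / n := by field_simp
    rw [e2, div_le_iff₀ hn]
    nlinarith [mul_le_mul_of_nonneg_left h1 (by positivity : 0 ≤ n * C₁)]
  have e2 : (n : ℝ) ^ (-2 : ℝ) ≤ c / n * Real.exp (-1) := by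
    rw [Real.rpow_neg hn.le, Real.rpow_two, Real.exp_neg]
    rw [div_le_iff₀ hc] at h4
    rw [div_mul_eq_mul_div, le_div_iff₀ hn, ← div_eq_mul_inv, le_div_iff₀ (Real.exp_pos 1)]
    have e3 : ((n : ℝ) ^ 2)⁻¹ * n * Real.exp 1 = Real.exp 1 / n := by field_simp
    rw [e3, div_le_iff₀ hn]
    linarith
  have e3 : Real.exp (-(w * Real.log n)) = (n : ℝ) ^ (-w) := by
    rw [Real.rpow_def_of_pos hn]
    ring_nf
  have e4 : -(2 * B + 2 + w) = -(2 * B) + (-2 + -w) := by ring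
  rw [e4, Real.rpow_add hn, Real.rpow_add hn, neg_add, Real.exp_add, e3, ← mul_assoc (c / n)]
  gcongr

end Rates

set_option maxHeartbeats 400000 in
/-- Lemma 6.2: partitions with a large-bias cell containing many
observations have vanishing posterior mass: for all a,u₀,u₁,u₂ > 0 and δ > 0 small
enough, for every sufficiently large M₁ with M₁ > 2u₀/√δ,
E[1_{Ω_n} Π(S : |ȳ_{I_x^S} − f₀(x)| > M₁ε_n, n_{I_x^S} > s_n(δ) | D_n)] = O(n^{−a}). -/
theorem statement18
    (t M η : ℝ → ℝ) (t₁ : ℝ) (hA1 : A1 t M η t₁)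
    (x : ℝ) (hx : x ∈ Set.Ioo (0 : ℝ) 1)
    (B C₁ C₂ B₀ c₀ c₁ p₀ p₁ : ℝ)
    (hB : 9 < B) (hC₁ : 0 < C₁) (hC₁₂ : C₁ ≤ C₂)
    (hB₀ : 0 < B₀) (hc₀ : 0 < c₀) (hc₀₁ : c₀ ≤ c₁)
    (hp₀ : 0 < p₀) (hp₀₁ : p₀ ≤ p₁)
    (f₀ : ℝ → ℝ) (hf₀ : f₀ ∈ HolderClass t M η)
    (hf₀B : ∃ b : ℝ, (∀ y ∈ Set.Icc (0 : ℝ) 1, |f₀ y| ≤ b) ∧ b < B₀)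
    (Nf : ℕ → ℕ) (z : ∀ n : ℕ, Knot (Nf n) → ℝ) (xd : ∀ n : ℕ, Fin n → ℝ)
    (g : ∀ n : ℕ, Knot (Nf n) → ℝ → ℝ) (pI : ℕ → ℝ → ℝ → ℝ)
    (hgrid : ∀ n : ℕ, 2 ≤ n → IsGrid n (Nf n) (z n) C₁ C₂)
    (hdens : ∀ n : ℕ, GoodDens (Nf n) (g n) c₀ c₁ B₀)
    (hpI : ∀ n : ℕ, ∀ a b : ℝ, a ≤ b → p₀ * (b - a) ≤ pI n a b ∧ pI n a b ≤ p₁ * (b - a))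
    (a u₀ u₁ u₂ : ℝ) (ha : 0 < a) (hu₀ : 0 < u₀) (hu₁ : 0 < u₁) (hu₂ : 0 < u₂) :
    ∃ δ₀ > (0 : ℝ), ∀ δ : ℝ, 0 < δ → δ ≤ δ₀ →
      ∃ M₁₀ : ℝ, ∀ M₁ ≥ M₁₀, 2 * u₀ / Real.sqrt δ < M₁ →
        ∃ C > (0 : ℝ), ∃ N : ℕ, ∀ n ≥ N,
          (if OmegaX n (Nf n) (xd n) (z n) (pI n) u₁ x then (1 : ℝ) else 0) *
            ∫ ε, (if OmegaY n (Nf n) (xd n) (z n) u₀ x ε ∧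
                    OmegaY2 n (Nf n) (xd n) (z n) u₂ x ε then (1 : ℝ) else 0) *
                partPost n (Nf n) (z n) (xd n) B (g n) (fun i => f₀ (xd n i) + ε i)
                  (fun S _ =>
                    M₁ * epsn t n x <
                      |ybarIx n (Nf n) (xd n) (z n) (fun i => f₀ (xd n i) + ε i) S x -
                        f₀ x| ∧
                    snD t n x δ < nIx n (Nf n) (xd n) (z n) S x)
              ∂regNoise n ≤ C * (n : ℝ) ^ (-a) := by
  obtain ⟨b, hb, hbB⟩ := hf₀B
  have hxI : x ∈ Set.Icc (0 : ℝ) 1 := ⟨hx.1.le, hx.2.le⟩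
  have htx : 0 < t x := hA1.ht₁.trans_le (hA1.t_lb x hxI)
  obtain ⟨Mmin, hMmin, hMle⟩ := hA1.M_lb
  have hMx : 0 ≤ M x := hMmin.le.trans (hMle x hxI)
  obtain ⟨emin, hemin, hele⟩ := hA1.eta_lb
  have hηx : 0 < η x := hemin.trans_le (hele x hxI)
  have hB0 : 0 ≤ B := by linarith
  set ρ := min 1 (B₀ - b) with hρ
  have hρ0 : 0 < ρ := lt_min zero_lt_one (by linarith)
  set k := 2 * B + 2 + u₂ ^ 2 with hk
  have hk0 : 0 ≤ k := by positivity
  refine ⟨1, one_pos, fun δ hδ _ => ?_⟩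
  refine ⟨max (max 1 (32 * (3 * k + a) / p₀))
    (max (2 * (M x + u₀ / Real.sqrt (p₀ / 4))) (2 * M x)), fun M₁ hM₁ hM₁δ => ?_⟩
  obtain ⟨hM₁a, hM₁b⟩ := max_le_iff.1 hM₁
  obtain ⟨hM₁1, hM₁a⟩ := max_le_iff.1 hM₁a
  obtain ⟨hM₁b, hM₁c⟩ := max_le_iff.1 hM₁b
  have hexp : 3 * k + a ≤ p₀ * M₁ ^ 2 / 32 := by
    rw [div_le_iff₀ hp₀] at hM₁a
    have : M₁ ≤ M₁ ^ 2 := le_self_pow₀ hM₁1 two_ne_zero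
    have := mul_le_mul_of_nonneg_left this hp₀.le
    linarith
  have ht2 : 0 < 2 * t x + 1 := by linarith
  have hs1 : 0 < 1 / (2 * t x + 1) := by positivity
  have hs2 : 0 < t x / (2 * t x + 1) := by positivity
  have hh0 := tendsto_rpow_neg_div_log hs1
  have he0 : Tendsto (fun n : ℕ => epsn t n x ^ 2) atTop (nhds 0) := by
    have := (tendsto_rpow_neg_div_log hs2).pow 2
    simpa [epsn, neg_div] using this
  have hlog := (Real.tendsto_log_atTop.comp tendsto_natCast_atTop_atTop).eventually_ge_atTop
    (1 : ℝ)
  have hev := (eventually_ge_atTop 2).and <| hlog.and <|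
    (hh0.eventually_lt_const (lt_min hηx (lt_min hx.1 (sub_pos.2 hx.2)))).and <|
    (he0.eventually_lt_const (show 0 < min (p₀ / (8 * u₁ ^ 2)) (1 / (2 * C₂)) from
      lt_min (by positivity) (by have := hC₁.trans_le hC₁₂; positivity))).and <|
    eventually_rpow_le (w := u₂ ^ 2) hB0 hC₁ (show 0 < c₀ * (2 * ρ) by positivity)
  obtain ⟨N, hN⟩ := eventually_atTop.1 hev
  refine ⟨4, by norm_num, N, fun n hn => ?_⟩
  obtain ⟨hn2, hL1, hhn, hen, hlam⟩ := hN n hn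
  simp only [Function.comp_apply] at hL1
  have hL : 0 < Real.log n := by linarith
  have hn0 : (0 : ℝ) < n := Nat.cast_pos.2 (by omega)
  have hn1 : (1 : ℝ) ≤ n := by exact_mod_cast (by omega : 1 ≤ n)
  have hR : 0 < (n : ℝ) / Real.log n := by positivity
  set h := ((n : ℝ) / Real.log n) ^ (-(1 / (2 * t x + 1))) with hh
  obtain ⟨hhη, hhn⟩ := lt_min_iff.1 hhn
  obtain ⟨hhx, hxh⟩ := lt_min_iff.1 hhn
  obtain ⟨hen1, hen2⟩ := lt_min_iff.1 hen
  have hhpos : 0 < h := Real.rpow_pos_of_pos hR _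
  have hepos : 0 < epsn t n x := Real.rpow_pos_of_pos hR _
  have hht : h ^ t x = epsn t n x := by
    rw [hh, ← Real.rpow_mul hR.le, epsn]
    congr 1
    ring
  have hhe : h * epsn t n x ^ 2 = Real.log n / n := by
    rw [hh, epsn, ← Real.rpow_natCast, ← Real.rpow_mul hR.le, ← Real.rpow_add hR]
    have : -(1 / (2 * t x + 1)) + -t x / (2 * t x + 1) * (2 : ℕ) = -1 := by
      push_cast
      field_simp
      ring
    rw [this, Real.rpow_neg_one, inv_div]
  have hnh : n * h * epsn t n x ^ 2 = Real.log n := by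
    rw [mul_assoc, hhe]
    field_simp
  have hsp : C₂ * Real.log n / n ≤ h / 2 := by
    have hC₂ := hC₁.trans_le hC₁₂
    rw [mul_div_assoc, ← hhe]
    rw [lt_div_iff₀ (by positivity)] at hen2
    nlinarith [mul_le_mul_of_nonneg_left hen2.le hhpos.le]
  have hue : 8 * u₁ ^ 2 * epsn t n x ^ 2 ≤ p₀ := by
    rw [lt_div_iff₀ (by positivity)] at hen1
    linarith
  have hrhs : 0 ≤ 4 * (n : ℝ) ^ (-a) := by positivity
  by_cases hX : OmegaX n (Nf n) (xd n) (z n) (pI n) u₁ x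
  swap
  · rwa [if_neg hX, zero_mul]
  rw [if_pos hX, one_mul]
  have hbound : 4 * ((((n : ℝ) ^ (-k)) ^ 3)⁻¹ * Real.exp (-(p₀ * M₁ ^ 2 * Real.log n / 32))) ≤
      4 * (n : ℝ) ^ (-a) := by
    have e1 : Real.exp (-(p₀ * M₁ ^ 2 * Real.log n / 32)) =
        (n : ℝ) ^ (-(p₀ * M₁ ^ 2 / 32)) := by
      rw [Real.rpow_def_of_pos hn0]
      ring_nf
    have e2 : (((n : ℝ) ^ (-k)) ^ 3)⁻¹ = (n : ℝ) ^ (3 * k) := by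
      rw [← Real.rpow_natCast, ← Real.rpow_mul hn0.le, ← Real.rpow_neg hn0.le]
      congr 1
      push_cast
      ring
    rw [e1, e2, ← Real.rpow_add hn0]
    refine mul_le_mul_of_nonneg_left (Real.rpow_le_rpow_of_exponent_le hn1 ?_) (by norm_num)
    linarith
  have hpost := fun (ε : Fin n → ℝ)
      (hΩ : OmegaY n (Nf n) (xd n) (z n) u₀ x ε ∧ OmegaY2 n (Nf n) (xd n) (z n) u₂ x ε) =>
    posterior_le (r := ρ / n) (lam := (n : ℝ) ^ (-k)) (b := b) hx hB0 hC₁ hc₀ hp₀ htx hMx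
      (hf₀ x hxI) hb (hgrid n hn2) (hdens n) (hpI n) hu₀ hδ hX hΩ.1 hΩ.2 (by omega) hL
      hepos hhpos hnh hht hsp hhη.le hhx (by linarith) hue (by positivity)
      (by
        have : ρ / n ≤ ρ := div_le_self hρ0.le hn1
        linarith [min_le_right 1 (B₀ - b)])
      (by
        have h1 : ρ ^ 2 ≤ 1 := pow_le_one₀ hρ0.le (min_le_left _ _)
        rw [div_pow, mul_div_assoc', div_le_one (by positivity)]
        nlinarith)
      (by positivity) (Real.rpow_le_one_of_one_le_of_nonpos hn1 (by linarith))
      (hlam.trans (le_of_eq (by ring))) hM₁b hM₁c hM₁δ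
  have : IsProbabilityMeasure (regNoise n) := by
    unfold regNoise stdGaussian
    infer_instance
  refine (integral_mono_of_nonneg (g := fun _ => 4 * (n : ℝ) ^ (-a)) ?_ (integrable_const _)
    ?_).trans (le_of_eq (by simp))
  · refine ae_of_all _ fun ε => ?_
    by_cases hΩ : OmegaY n (Nf n) (xd n) (z n) u₀ x ε ∧ OmegaY2 n (Nf n) (xd n) (z n) u₂ x ε
    · simp only [if_pos hΩ, one_mul]
      exact (hpost ε hΩ).1
    · simp only [if_neg hΩ, zero_mul]
      exact le_rfl
  · refine ae_of_all _ fun ε => ?_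
    by_cases hΩ : OmegaY n (Nf n) (xd n) (z n) u₀ x ε ∧ OmegaY2 n (Nf n) (xd n) (z n) u₂ x ε
    · simp only [if_pos hΩ, one_mul]
      exact (hpost ε hΩ).2.trans hbound
    · simp only [if_neg hΩ, zero_mul]
      exact hrhs

end Spatial
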